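/- arXiv:2209.11184 — 5 statements merged into one kernel-verified Lean document; each statement's English description precedes it below -/
import Mathlib

section
/- For any smooth (C^∞) function k : ℝ → ℝ, the function S : ℝ² → ℝ defined by S(t,r) = S_{k(t)}(r) is smooth (C^∞) on ℝ². -/
open Real

/-- The function `S_k(r)`: `sin(√k r)/√k` for `k > 0`, `r` for `k = 0`,
and `sinh(√(-k) r)/√(-k)` for `k < 0`. -/
noncomputable def Sk (k r : ℝ) : ℝ :=
  if 0 < k then Real.sin (Real.sqrt k * r) / Real.sqrt k
  else if k = 0 then r
  else Real.sinh (Real.sqrt (-k) * r) / Real.sqrt (-k)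

/-- Coefficients of the entire function `u ↦ sin(√u)/√u`. -/
noncomputable def cSk (n : ℕ) : ℝ := (-1) ^ n / (Nat.factorial (2 * n + 1) : ℝ)

lemma cSk_radius : (FormalMultilinearSeries.ofScalars ℝ cSk).radius = ⊤ := by
  apply FormalMultilinearSeries.ofScalars_radius_eq_top_of_tendsto
  · refine Filter.Eventually.of_forall fun n => ?_
    unfold cSk
    have : (Nat.factorial (2 * n + 1) : ℝ) ≠ 0 := Nat.cast_ne_zero.mpr (Nat.factorial_ne_zero _)
    positivity
  · refine squeeze_zero (fun n => by positivity) (fun n => ?_)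
      (tendsto_one_div_add_atTop_nhds_zero_nat (𝕜 := ℝ))
    have h : (0 : ℝ) < (Nat.factorial (2 * n + 1) : ℝ) := by exact_mod_cast Nat.factorial_pos _
    have e : (Nat.factorial (2 * (n + 1) + 1) : ℝ)
        = (2 * n + 3) * ((2 * n + 2) * (Nat.factorial (2 * n + 1) : ℝ)) := by
      rw [show 2 * (n + 1) + 1 = (2 * n + 1) + 1 + 1 by ring, Nat.factorial_succ,
        Nat.factorial_succ]
      push_cast
      ring
    simp only [cSk, Nat.succ_eq_add_one, norm_div, norm_pow, norm_neg, norm_one, one_pow]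
    rw [e, Real.norm_of_nonneg h.le, Real.norm_of_nonneg (by positivity)]
    rw [div_div_eq_mul_div, div_one, one_div, inv_mul_eq_div,
      div_le_div_iff₀ (by positivity) (by positivity)]
    have hn : (0 : ℝ) ≤ n := Nat.cast_nonneg n
    have : 0 ≤ ((2 * (n : ℝ) + 3) * (2 * n + 2) - (n + 1)) * (Nat.factorial (2 * n + 1) : ℝ) := by
      apply mul_nonneg _ h.le
      nlinarith
    nlinarith

/-- The entire function `u ↦ sin(√u)/√u`. -/
noncomputable def FSk (u : ℝ) : ℝ := (FormalMultilinearSeries.ofScalars ℝ cSk).sum u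

lemma FSk_contDiff : ContDiff ℝ (⊤ : ℕ∞) FSk := by
  have h := (FormalMultilinearSeries.ofScalars ℝ cSk).hasFPowerSeriesOnBall
    (by rw [cSk_radius]; exact ENNReal.zero_lt_top)
  rw [cSk_radius] at h
  rw [contDiff_iff_contDiffAt]
  intro x
  exact (h.analyticAt_of_mem (by simp)).contDiffAt

lemma FSk_eq (u : ℝ) : FSk u = ∑' n : ℕ, cSk n * u ^ n := by
  have := FormalMultilinearSeries.ofScalars_sum_eq (E := ℝ) cSk u
  simpa [FSk, FormalMultilinearSeries.ofScalarsSum] using this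

lemma Sk_eq (k r : ℝ) : Sk k r = r * FSk (k * r ^ 2) := by
  rw [FSk_eq, ← tsum_mul_left]
  unfold Sk
  split_ifs with h1 h2
  · have hs : √k ≠ 0 := (Real.sqrt_pos.mpr h1).ne'
    rw [Real.sin_eq_tsum, ← tsum_div_const]
    congr 1
    ext n
    have e : k * r ^ 2 = (√k * r) ^ 2 := by rw [mul_pow, Real.sq_sqrt h1.le]
    rw [e, ← pow_mul, pow_succ, cSk]
    field_simp
  · subst h2
    rw [tsum_eq_single 0 (fun n hn => by simp [hn])]
    simp [cSk]
  · have h3 : 0 < -k := by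
      rcases lt_trichotomy k 0 with h | h | h
      · linarith
      · exact absurd h h2
      · exact absurd h h1
    have hs : √(-k) ≠ 0 := (Real.sqrt_pos.mpr h3).ne'
    rw [Real.sinh_eq_tsum, ← tsum_div_const]
    congr 1
    ext n
    have e : k * r ^ 2 = (-1) * (√(-k) * r) ^ 2 := by
      rw [mul_pow, Real.sq_sqrt h3.le]; ring
    have s : ((-1 : ℝ)) ^ n * (-1) ^ n = 1 := by rw [← mul_pow]; simp
    rw [e, mul_pow (-1 : ℝ), ← pow_mul, pow_succ, cSk]
    calc _ = r * (((-1 : ℝ)) ^ n * (-1) ^ n) * (√(-k) * r) ^ (2 * n)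
          / (Nat.factorial (2 * n + 1) : ℝ) := by
          rw [s]; field_simp
      _ = _ := by ring

/-- For any smooth `k : ℝ → ℝ`, the function `S(t,r) := S_{k(t)}(r)` is smooth on `ℝ²`. -/
theorem stmt_2 (k : ℝ → ℝ) (hk : ContDiff ℝ (⊤ : ℕ∞) k) :
    ContDiff ℝ (⊤ : ℕ∞) (fun p : ℝ × ℝ => Sk (k p.1) p.2) := by
  simp only [Sk_eq]
  exact contDiff_snd.mul (FSk_contDiff.comp ((hk.comp contDiff_fst).mul (contDiff_snd.pow 2)))
end

section
/- For every k ∈ ℝ and r ∈ ℝ, the partial derivative of S_k(r) with respect to k exists and equals ∂_k S_k(r) = −∑_{m=1}^∞ m·(−k)^{m−1}·r^{2m+1}/(2m+1)!; in particular ∂_k S_k(r) evaluated at k = 0 equals −r³/6. -/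
open Real

theorem Sk_hasSum (k r : ℝ) :
    HasSum (fun n : ℕ => (-k) ^ n * r ^ (2 * n + 1) / (Nat.factorial (2 * n + 1) : ℝ)) (Sk k r) := by
  unfold Sk
  split_ifs with h1 h2
  · have hs : Real.sqrt k ≠ 0 := (Real.sqrt_pos.mpr h1).ne'
    have hk : Real.sqrt k ^ 2 = k := Real.sq_sqrt h1.le
    convert! (Real.hasSum_sin (Real.sqrt k * r)).div_const (Real.sqrt k) using 1
    funext n
    have : (-k) ^ n = (-1) ^ n * Real.sqrt k ^ (2 * n) := by
      rw [pow_mul, hk, neg_pow]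
    rw [this, mul_pow, pow_succ (Real.sqrt k)]
    field_simp
  · subst h2
    convert! hasSum_single (f := fun n : ℕ =>
      (-(0:ℝ)) ^ n * r ^ (2 * n + 1) / (Nat.factorial (2 * n + 1) : ℝ)) 0 ?_ using 1
    · simp
    · intro n hn
      simp [hn]
  · have h3 : 0 < -k := by
      rcases lt_trichotomy k 0 with h | h | h
      · linarith
      · exact absurd h h2
      · exact absurd h h1
    have hs : Real.sqrt (-k) ≠ 0 := (Real.sqrt_pos.mpr h3).ne'
    have hk : Real.sqrt (-k) ^ 2 = -k := Real.sq_sqrt h3.le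
    convert! (Real.hasSum_sinh (Real.sqrt (-k) * r)).div_const (Real.sqrt (-k)) using 1
    funext n
    have : (-k) ^ n = Real.sqrt (-k) ^ (2 * n) := by
      rw [pow_mul, hk]
    rw [this, mul_pow, pow_succ (Real.sqrt (-k))]
    field_simp

theorem Sk_eq_s4 (k r : ℝ) : Sk k r = r + ∑' m : ℕ, (-k) ^ (m + 1) * r ^ (2 * (m + 1) + 1) /
    (Nat.factorial (2 * (m + 1) + 1) : ℝ) := by
  rw [← (Sk_hasSum k r).tsum_eq, (Sk_hasSum k r).summable.tsum_eq_zero_add]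
  simp

theorem Sk_deriv (k r : ℝ) :
      HasDerivAt (fun κ => Sk κ r)
        (-(∑' m : ℕ, ((m : ℝ) + 1) * (-k) ^ m * r ^ (2 * (m + 1) + 1) /
            (Nat.factorial (2 * (m + 1) + 1)))) k := by
  simp_rw [Sk_eq_s4]
  rw [← tsum_neg]
  apply HasDerivAt.const_add
  have hu : Summable (fun m : ℕ => |r| ^ 3 * (((|k| + 1) * |r| ^ 2) ^ m / (Nat.factorial m : ℝ))) :=
    (Real.summable_pow_div_factorial _).mul_left _
  refine hasDerivAt_tsum_of_isPreconnected (t := Metric.ball (0:ℝ) (|k| + 1)) (y₀ := 0)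
    (g := fun (m : ℕ) κ => (-κ) ^ (m + 1) * r ^ (2 * (m + 1) + 1) /
      (Nat.factorial (2 * (m + 1) + 1) : ℝ))
    (g' := fun (m : ℕ) κ => -(((m : ℝ) + 1) * (-κ) ^ m * r ^ (2 * (m + 1) + 1) /
            (Nat.factorial (2 * (m + 1) + 1))))
    hu Metric.isOpen_ball (convex_ball _ _).isPreconnected ?_ ?_ ?_ ?_ ?_
  · intro m y _
    have h := ((((hasDerivAt_id y).neg).pow (m + 1)).mul_const (r ^ (2 * (m + 1) + 1))).div_const
      (Nat.factorial (2 * (m + 1) + 1) : ℝ)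
    convert! h using 1
    simp
    ring
  · intro m y hy
    have hy' : |y| ≤ |k| + 1 := by simpa using (mem_ball_zero_iff.mp hy).le
    have hf : ((m : ℝ) + 1) * (Nat.factorial m : ℝ) ≤ (Nat.factorial (2 * (m + 1) + 1) : ℝ) := by
      have : Nat.factorial (m + 1) ≤ Nat.factorial (2 * (m + 1) + 1) :=
        Nat.factorial_le (by omega)
      rw [Nat.factorial_succ] at this
      exact_mod_cast this
    have hm : (0:ℝ) < Nat.factorial m := by exact_mod_cast Nat.factorial_pos m
    have hM : (0:ℝ) < Nat.factorial (2 * (m + 1) + 1) := by exact_mod_cast Nat.factorial_pos _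
    have h1 : |(m:ℝ) + 1| = m + 1 := abs_of_pos (by positivity)
    rw [norm_neg, Real.norm_eq_abs, abs_div, abs_mul, abs_mul, abs_pow, abs_pow, abs_neg, h1,
      abs_of_pos hM]
    have hp : |y| ^ m ≤ (|k| + 1) ^ m := pow_le_pow_left₀ (abs_nonneg _) hy' m
    calc ((m:ℝ) + 1) * |y| ^ m * |r| ^ (2 * (m + 1) + 1) / (Nat.factorial (2 * (m + 1) + 1) : ℝ)
        ≤ ((m:ℝ) + 1) * (|k| + 1) ^ m * |r| ^ (2 * (m + 1) + 1) /
          (((m : ℝ) + 1) * (Nat.factorial m : ℝ)) := by gcongr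
      _ = _ := by
        have : |r| ^ (2 * (m + 1) + 1) = |r| ^ 3 * (|r| ^ 2) ^ m := by ring
        rw [this, mul_pow]
        field_simp
  · simp; positivity
  · simp
  · simp

/-- The partial derivative of `S_k(r)` in `k` exists and equals
`−∑_{m=1}^∞ m (−k)^{m−1} r^{2m+1}/(2m+1)!` (the sum below is reindexed by `m ↦ m+1`);
in particular at `k = 0` it equals `−r³/6`. -/
theorem stmt_4 :
    (∀ k r : ℝ,
      HasDerivAt (fun κ => Sk κ r)
        (-(∑' m : ℕ, ((m : ℝ) + 1) * (-k) ^ m * r ^ (2 * (m + 1) + 1) /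
            (Nat.factorial (2 * (m + 1) + 1)))) k) ∧
    (∀ r : ℝ, HasDerivAt (fun κ => Sk κ r) (-(r ^ 3) / 6) 0) := by
  refine ⟨Sk_deriv, fun r => ?_⟩
  convert! Sk_deriv 0 r using 1
  rw [tsum_eq_single 0]
  · simp [Nat.factorial]
    ring
  · intro n hn
    simp [hn]
end

section
/- Let k : ℝ → ℝ be differentiable with derivative k′. Then for every t ∈ ℝ and r ∈ ℝ, the partial derivative in t of S(t,r) := S_{k(t)}(r) exists and equals ∂_t S(t,r) = k′(t) · (∂_k S_κ(r))|_{κ=k(t)}; in particular ∂_t S(t₀,r) = 0 for every r whenever k′(t₀) = 0. -/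
open Real

theorem aux_sinh {x : ℝ} (hx : |x| ≤ 1) : |Real.sinh x - (x + x ^ 3 / 6)| ≤ |x| ^ 4 * (5 / 96) := by
  have h1 := Real.exp_bound hx (n := 4) (by norm_num)
  have h2 := Real.exp_bound (x := -x) (by rwa [abs_neg]) (n := 4) (by norm_num)
  rw [abs_neg] at h2
  norm_num [Finset.sum_range_succ, Nat.factorial] at h1 h2
  rw [Real.sinh_eq]
  rw [abs_le] at *
  constructor <;> linarith [h1.1, h1.2, h2.1, h2.2]

theorem aux_div {s r y c : ℝ} (hs : 0 < s) (h : |y - (s * r + c * (s * r) ^ 3 / 6)| ≤ |s * r| ^ 4 * (5 / 96)) :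
    |(y / s - r) / s ^ 2 - c * r ^ 3 / 6| ≤ s * r ^ 4 := by
  have e : (y / s - r) / s ^ 2 - c * r ^ 3 / 6 = (y - (s * r + c * (s * r) ^ 3 / 6)) / s ^ 3 := by
    field_simp
    ring
  rw [e, abs_div, abs_of_pos (pow_pos hs 3), div_le_iff₀ (pow_pos hs 3)]
  refine h.trans ?_
  have e4 : |s * r| ^ 4 = (s * r) ^ 4 := by
    rw [← abs_pow, abs_of_nonneg (by positivity)]
  rw [e4]
  have : 0 ≤ (s * r) ^ 4 := by positivity
  nlinarith

theorem aux_zero (r : ℝ) : HasDerivAt (fun κ => Sk κ r) (-r ^ 3 / 6) 0 := by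
  rw [hasDerivAt_iff_tendsto_slope, tendsto_iff_norm_sub_tendsto_zero]
  have hlim : Filter.Tendsto (fun κ : ℝ => √|κ| * r ^ 4) (nhdsWithin 0 {0}ᶜ) (nhds 0) := by
    have : Continuous (fun κ : ℝ => √|κ| * r ^ 4) := by fun_prop
    have h := this.tendsto 0
    simp only [abs_zero, Real.sqrt_zero, zero_mul] at h
    exact h.mono_left nhdsWithin_le_nhds
  have hsm : ∀ᶠ κ : ℝ in nhdsWithin 0 {0}ᶜ, |√|κ| * r| < 1 := by
    have : Continuous (fun κ : ℝ => |√|κ| * r|) := by fun_prop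
    have h := this.tendsto 0
    simp only [abs_zero, Real.sqrt_zero, zero_mul] at h
    exact (h.mono_left nhdsWithin_le_nhds).eventually (gt_mem_nhds one_pos)
  refine squeeze_zero' (Filter.Eventually.of_forall fun _ => norm_nonneg _) ?_ hlim
  filter_upwards [hsm, self_mem_nhdsWithin] with κ h1 h0
  have h0 : κ ≠ 0 := h0
  rw [slope_def_field, Real.norm_eq_abs]
  have hz : Sk 0 r = r := by simp [Sk]
  rw [hz, sub_zero]
  rcases lt_or_gt_of_ne h0 with hn | hp
  · rw [abs_of_neg hn] at h1 ⊢
    have hs : 0 < √(-κ) := Real.sqrt_pos.2 (by linarith)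
    have := aux_div (c := 1) (y := Real.sinh (√(-κ) * r)) hs (by simpa using aux_sinh h1.le)
    rw [Real.sq_sqrt (by linarith)] at this
    have e : Sk κ r = Real.sinh (√(-κ) * r) / √(-κ) := by
      simp [Sk, h0, not_lt.2 hn.le]
    rw [e, ← abs_neg]
    convert this using 2
    rw [div_neg]
    ring
  · rw [abs_of_pos hp] at h1 ⊢
    have hs : 0 < √κ := Real.sqrt_pos.2 hp
    have := aux_div (r := r) (c := -1) (y := Real.sin (√κ * r)) hs (by
      have hb := Real.sin_bound h1.le
      have e : √κ * r + -1 * (√κ * r) ^ 3 / 6 = √κ * r - (√κ * r) ^ 3 / 6 := by ring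
      rw [e]
      refine hb.trans ?_
      have h4 : 0 ≤ |√κ * r| ^ 4 := by positivity
      have h5 : |√κ * r| ^ 5 ≤ |√κ * r| ^ 4 :=
        pow_le_pow_of_le_one (abs_nonneg _) h1.le (by norm_num)
      linarith)
    rw [Real.sq_sqrt hp.le] at this
    have e : Sk κ r = Real.sin (√κ * r) / √κ := by
      simp [Sk, hp]
    rw [e]
    convert this using 2
    ring

theorem aux_diff (r κ : ℝ) : DifferentiableAt ℝ (fun κ => Sk κ r) κ := by
  rcases lt_trichotomy κ 0 with hn | rfl | hp
  · have hs : √(-κ) ≠ 0 := (Real.sqrt_pos.2 (by linarith)).ne'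
    have hd : DifferentiableAt ℝ (fun κ : ℝ => √(-κ)) κ :=
      (differentiableAt_id.neg).sqrt (by simpa using hn.ne)
    have : DifferentiableAt ℝ (fun κ : ℝ => Real.sinh (√(-κ) * r) / √(-κ)) κ :=
      ((hd.mul_const r).sinh).div hd hs
    refine this.congr_of_eventuallyEq ?_
    filter_upwards [gt_mem_nhds hn] with x hx
    simp [Sk, hx.ne, not_lt.2 hx.le]
  · exact (aux_zero r).differentiableAt
  · have hs : √κ ≠ 0 := (Real.sqrt_pos.2 hp).ne'
    have hd : DifferentiableAt ℝ (fun κ : ℝ => √κ) κ := differentiableAt_id.sqrt hp.ne'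
    have : DifferentiableAt ℝ (fun κ : ℝ => Real.sin (√κ * r) / √κ) κ :=
      ((hd.mul_const r).sin).div hd hs
    refine this.congr_of_eventuallyEq ?_
    filter_upwards [lt_mem_nhds hp] with x hx
    simp [Sk, hx]

/-- If `k : ℝ → ℝ` is differentiable with derivative `k'`, then
`∂_t S(t,r) = k'(t) · (∂_κ S_κ(r))|_{κ = k(t)}`; in particular `∂_t S(t₀,·) = 0`
whenever `k'(t₀) = 0`. -/
theorem stmt_5 (k k' : ℝ → ℝ) (hk : ∀ t, HasDerivAt k (k' t) t) :
    (∀ t r : ℝ,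
      HasDerivAt (fun τ => Sk (k τ) r) (k' t * deriv (fun κ => Sk κ r) (k t)) t) ∧
    (∀ t₀ : ℝ, k' t₀ = 0 → ∀ r : ℝ, HasDerivAt (fun τ => Sk (k τ) r) 0 t₀) := by
  have h : ∀ t r : ℝ,
      HasDerivAt (fun τ => Sk (k τ) r) (k' t * deriv (fun κ => Sk κ r) (k t)) t := by
    intro t r
    rw [mul_comm]
    exact (aux_diff r (k t)).hasDerivAt.comp t (hk t)
  refine ⟨h, fun t₀ h0 r => ?_⟩
  have := h t₀ r
  rwa [h0, zero_mul] at this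
end

section
/- Fix n ≥ 1. The function G : ℝ × ℝⁿ → ℝ defined by G(k,x) = −∑_{m=0}^∞ (−k)^{m+1} · ‖x‖^{2m}/(2m+3)! is real-analytic on ℝ × ℝⁿ, and for every x ≠ 0 one has G(k,x) = (1/‖x‖²)·(1 − S_k(‖x‖)/‖x‖). -/
open Real

theorem aux_hasSum_Sk (k r : ℝ) :
    HasSum (fun m : ℕ => (-k) ^ m * r ^ (2 * m + 1) / (Nat.factorial (2 * m + 1) : ℝ)) (Sk k r) := by
  unfold Sk
  split_ifs with h1 h2
  · have hs : 0 < Real.sqrt k := Real.sqrt_pos.mpr h1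
    have hq : Real.sqrt k ^ 2 = k := Real.sq_sqrt h1.le
    have := (Real.hasSum_sin (Real.sqrt k * r)).div_const (Real.sqrt k)
    refine (congrArg (fun f => HasSum f _) (funext fun m => ?_)).mpr this
    have e : (-k) ^ m = (-1) ^ m * (Real.sqrt k) ^ (2 * m) := by
      rw [pow_mul, hq, ← mul_pow]; ring
    rw [e]
    field_simp
    ring
  · subst h2
    convert hasSum_single (0 : ℕ) ?_ using 1
    · simp
    · intro m hm
      simp [hm]
  · have hk : 0 < -k := by
      rcases lt_trichotomy k 0 with h | h | h
      · linarith
      · exact absurd h h2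
      · exact absurd h h1
    have hs : 0 < Real.sqrt (-k) := Real.sqrt_pos.mpr hk
    have hq : Real.sqrt (-k) ^ 2 = -k := Real.sq_sqrt hk.le
    have := (Real.hasSum_sinh (Real.sqrt (-k) * r)).div_const (Real.sqrt (-k))
    refine (congrArg (fun f => HasSum f _) (funext fun m => ?_)).mpr this
    have e : (-k) ^ m = (Real.sqrt (-k)) ^ (2 * m) := by
      rw [pow_mul, hq]
    rw [e]
    field_simp
    ring

theorem aux_radius :
    (FormalMultilinearSeries.ofScalars ℝ
      (fun m : ℕ => ((Nat.factorial (2 * m + 3) : ℝ))⁻¹)).radius = ⊤ := by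
  refine FormalMultilinearSeries.radius_eq_top_of_summable_norm _ fun r => ?_
  refine Summable.of_nonneg_of_le (fun m => by positivity) (fun m => ?_)
    (Real.summable_pow_div_factorial (r : ℝ))
  rw [FormalMultilinearSeries.ofScalars_norm, norm_inv, Real.norm_natCast, div_eq_inv_mul]
  have : (Nat.factorial m : ℝ) ≤ (Nat.factorial (2 * m + 3) : ℝ) :=
    mod_cast Nat.factorial_le (by omega)
  gcongr

theorem aux_analytic (t : ℝ) :
    AnalyticAt ℝ (fun t : ℝ => ∑' m : ℕ, ((Nat.factorial (2 * m + 3) : ℝ))⁻¹ * t ^ m) t := by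
  have h := (FormalMultilinearSeries.ofScalars ℝ
      (fun m : ℕ => ((Nat.factorial (2 * m + 3) : ℝ))⁻¹)).hasFPowerSeriesOnBall
      (by rw [aux_radius]; simp)
  rw [aux_radius] at h
  have h2 := h.analyticAt_of_mem (y := t) (by simp)
  have e := FormalMultilinearSeries.ofScalarsSum_eq_tsum (E := ℝ)
    (fun m : ℕ => ((Nat.factorial (2 * m + 3) : ℝ))⁻¹)
  simp only [smul_eq_mul] at e
  rw [← e]
  exact h2

/-- `G(k,x) = −∑_{m=0}^∞ (−k)^{m+1} ‖x‖^{2m}/(2m+3)!` is real-analytic on `ℝ × ℝⁿ`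
and equals `(1/‖x‖²)(1 − S_k(‖x‖)/‖x‖)` for `x ≠ 0`. -/
theorem stmt_9 (n : ℕ) (hn : 1 ≤ n)
    (G : ℝ × EuclideanSpace ℝ (Fin n) → ℝ)
    (hG : ∀ p : ℝ × EuclideanSpace ℝ (Fin n),
      G p = -∑' m : ℕ, (-p.1) ^ (m + 1) * ‖p.2‖ ^ (2 * m) / (Nat.factorial (2 * m + 3))) :
    (∀ p : ℝ × EuclideanSpace ℝ (Fin n), AnalyticAt ℝ G p) ∧
    (∀ (k : ℝ) (x : EuclideanSpace ℝ (Fin n)), x ≠ 0 →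
      G (k, x) = (1 / ‖x‖ ^ 2) * (1 - Sk k ‖x‖ / ‖x‖)) := by
  constructor
  · intro p
    have hfun : G = fun p => p.1 * (fun t : ℝ => ∑' m : ℕ,
        ((Nat.factorial (2 * m + 3) : ℝ))⁻¹ * t ^ m) (-p.1 * ‖p.2‖ ^ 2) := by
      funext q
      rw [hG q]
      simp only
      rw [← tsum_mul_left, ← tsum_neg]
      refine tsum_congr fun m => ?_
      rw [mul_pow, ← pow_mul]
      ring
    rw [hfun]
    have hn : AnalyticAt ℝ (fun p : ℝ × EuclideanSpace ℝ (Fin n) => ‖p.2‖ ^ 2) p :=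
      (((contDiff_norm_sq ℝ).comp contDiff_snd).contDiffAt).analyticAt
    have hi : AnalyticAt ℝ (fun p : ℝ × EuclideanSpace ℝ (Fin n) => -p.1 * ‖p.2‖ ^ 2) p :=
      analyticAt_fst.neg.mul hn
    exact analyticAt_fst.mul ((aux_analytic _).fun_comp hi)
  · intro k x hx
    have hr : ‖x‖ ≠ 0 := norm_ne_zero_iff.mpr hx
    have h := (hasSum_nat_add_iff' 1).mpr (aux_hasSum_Sk k ‖x‖)
    have h2 := (h.div_const (‖x‖ ^ 3)).tsum_eq
    rw [hG]
    simp only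
    have e : ∀ m : ℕ, (-k) ^ (m + 1) * ‖x‖ ^ (2 * m) / (Nat.factorial (2 * m + 3) : ℝ) =
        (-k) ^ (m + 1) * ‖x‖ ^ (2 * (m + 1) + 1) / (Nat.factorial (2 * (m + 1) + 1) : ℝ)
          / ‖x‖ ^ 3 := by
      intro m
      rw [show 2 * (m + 1) + 1 = 2 * m + 3 by ring, pow_add ‖x‖ (2 * m) 3]
      field_simp
    rw [tsum_congr e, h2]
    simp
    field_simp
    ring
end

section
/- For every k ≠ 0 and every r ∈ ℝ, the partial derivatives with respect to k satisfy ∂_k S_k(r) = (1/(2k))·(r·C_k(r) − S_k(r)) and ∂_k C_k(r) = −(r/2)·S_k(r). -/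
open Real

/-- The function `C_k(r)`: `cos(√k r)` for `k > 0`, `1` for `k = 0`,
and `cosh(√(-k) r)` for `k < 0`. -/
noncomputable def Ck (k r : ℝ) : ℝ :=
  if 0 < k then Real.cos (Real.sqrt k * r)
  else if k = 0 then 1
  else Real.cosh (Real.sqrt (-k) * r)

/-- For `k ≠ 0`: `∂_k S_k(r) = (1/(2k))(r C_k(r) − S_k(r))` and
`∂_k C_k(r) = −(r/2) S_k(r)`. -/
theorem stmt_17 (k : ℝ) (hk : k ≠ 0) (r : ℝ) :
    HasDerivAt (fun κ => Sk κ r) ((1 / (2 * k)) * (r * Ck k r - Sk k r)) k ∧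
    HasDerivAt (fun κ => Ck κ r) (-(r / 2) * Sk k r) k := by
  rcases lt_or_gt_of_ne hk with h | h
  · have h' : 0 < -k := by linarith
    have hs : 0 < Real.sqrt (-k) := Real.sqrt_pos.2 h'
    have hq : k = -(Real.sqrt (-k) ^ 2) := by rw [Real.sq_sqrt h'.le]; ring
    have hd : HasDerivAt (fun κ : ℝ => Real.sqrt (-κ)) (-1 / (2 * Real.sqrt (-k))) k :=
      (hasDerivAt_neg k).sqrt h'.ne'
    have hdr := hd.mul_const r
    have ev : ∀ᶠ κ in nhds k, κ < 0 := eventually_lt_nhds h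
    have eS : ∀ κ : ℝ, κ < 0 → Sk κ r = Real.sinh (Real.sqrt (-κ) * r) / Real.sqrt (-κ) := by
      intro κ hκ
      simp [Sk, not_lt.2 hκ.le, hκ.ne]
    have eC : ∀ κ : ℝ, κ < 0 → Ck κ r = Real.cosh (Real.sqrt (-κ) * r) := by
      intro κ hκ
      simp [Ck, not_lt.2 hκ.le, hκ.ne]
    rw [eS k h, eC k h]
    constructor
    · refine HasDerivAt.congr_of_eventuallyEq ?_ (ev.mono eS)
      refine HasDerivAt.congr_deriv (hdr.sinh.div hd hs.ne') ?_
      generalize Real.sqrt (-k) = s at *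
      subst hq
      field_simp
      ring
    · refine HasDerivAt.congr_of_eventuallyEq ?_ (ev.mono eC)
      refine HasDerivAt.congr_deriv (hdr.cosh) ?_
      field_simp
  · have hs : 0 < Real.sqrt k := Real.sqrt_pos.2 h
    have hq : k = Real.sqrt k ^ 2 := (Real.sq_sqrt h.le).symm
    have hd : HasDerivAt (fun κ : ℝ => Real.sqrt κ) (1 / (2 * Real.sqrt k)) k :=
      Real.hasDerivAt_sqrt h.ne'
    have hdr := hd.mul_const r
    have ev : ∀ᶠ κ in nhds k, 0 < κ := eventually_gt_nhds h
    have eS : ∀ κ : ℝ, 0 < κ → Sk κ r = Real.sin (Real.sqrt κ * r) / Real.sqrt κ := by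
      intro κ hκ
      simp [Sk, hκ]
    have eC : ∀ κ : ℝ, 0 < κ → Ck κ r = Real.cos (Real.sqrt κ * r) := by
      intro κ hκ
      simp [Ck, hκ]
    rw [eS k h, eC k h]
    constructor
    · refine HasDerivAt.congr_of_eventuallyEq ?_ (ev.mono eS)
      refine HasDerivAt.congr_deriv (hdr.sin.div hd hs.ne') ?_
      generalize Real.sqrt k = s at *
      subst hq
      field_simp
    · refine HasDerivAt.congr_of_eventuallyEq ?_ (ev.mono eC)
      refine HasDerivAt.congr_deriv (hdr.cos) ?_
      field_simp
end
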